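/- For each N ∈ ℕ let Ĥ_N : 𝒫(V) → ℝ be a random function (each Ĥ_N(S) is a real-valued random variable) such that for every S ⊆ V, Ĥ_N(S) converges to H(S) in probability as N → ∞. Let L and L' be finite lists of CI-triples over V with associated imsets u = Σ_{l∈L} u_l and u' = Σ_{l∈L'} u_l, and let d, d' ∈ ℝ. Define the random scores S_N = −2N·⟨δ_V − u, Ĥ_N⟩ + d·log N and S'_N = −2N·⟨δ_V − u', Ĥ_N⟩ + d'·log N. If every triple in L holds under P and some triple in L' does not hold under P, then P(S_N < S'_N) → 1 as N → ∞. -/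

import Mathlib

open MeasureTheory

namespace ImsetScore

variable {V : Type*} [Fintype V] [DecidableEq V]

/-- A CI-triple `⟨A,B|C⟩` over `V`: pairwise disjoint subsets with `A, B` nonempty. -/
structure CITriple (V : Type*) where
  A : Finset V
  B : Finset V
  C : Finset V
  hA : A.Nonempty
  hB : B.Nonempty
  hAB : Disjoint A B
  hAC : Disjoint A C
  hBC : Disjoint B C

/-- The delta imset `δ_S`. -/
def deltaImset (S : Finset V) : Finset V → ℤ := fun T => if T = S then 1 else 0

/-- The semi-elementary imset of a CI-triple:
`u_{⟨A,B|C⟩} = δ_{A∪C} + δ_{B∪C} − δ_{A∪B∪C} − δ_C`. -/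
def semiElem (t : CITriple V) : Finset V → ℤ := fun T =>
  deltaImset (t.A ∪ t.C) T + deltaImset (t.B ∪ t.C) T
    - deltaImset (t.A ∪ t.B ∪ t.C) T - deltaImset t.C T

/-- The pairing `⟨u, f⟩ = Σ_{S ⊆ V} u(S) · f(S)`. -/
def imsetInner (u : Finset V → ℤ) (f : Finset V → ℝ) : ℝ :=
  ∑ S : Finset V, (u S : ℝ) * f S

variable {Ω : Type*} [MeasurableSpace Ω] {E : Type*} [Fintype E] [DecidableEq E]

/-- The Shannon entropy `H(S)` of the tuple of random variables `(X_v)_{v ∈ S}`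
(with the convention `0 · log 0 = 0`; in particular `H(∅) = 0`). -/
noncomputable def jointEntropy (P : Measure Ω) (X : V → Ω → E) (S : Finset V) : ℝ :=
  -∑ a : {x // x ∈ S} → E,
      (P {ω | ∀ v : {x // x ∈ S}, X v.1 ω = a v}).toReal *
        Real.log (P {ω | ∀ v : {x // x ∈ S}, X v.1 ω = a v}).toReal

/-- Conditional mutual information
`I[X_A : X_B | X_C] = H(A∪C) + H(B∪C) − H(A∪B∪C) − H(C)`. -/
noncomputable def cmi (P : Measure Ω) (X : V → Ω → E) (A B C : Finset V) : ℝ :=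
  jointEntropy P X (A ∪ C) + jointEntropy P X (B ∪ C)
    - jointEntropy P X (A ∪ B ∪ C) - jointEntropy P X C

/-- The event `{X_v = a_v for all v ∈ S}`. -/
def cylinder (X : V → Ω → E) (S : Finset V) (a : V → E) : Set Ω :=
  {ω | ∀ v ∈ S, X v ω = a v}

/-- `X_A` and `X_B` are conditionally independent given `X_C` under `P`
(the triple `⟨A,B|C⟩` holds under `P`). -/
def CondIndepOn (P : Measure Ω) (X : V → Ω → E) (A B C : Finset V) : Prop :=
  ∀ a : V → E,
    P (cylinder X (A ∪ B ∪ C) a) * P (cylinder X C a)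
      = P (cylinder X (A ∪ C) a) * P (cylinder X (B ∪ C) a)

end ImsetScore

open ImsetScore

namespace ImsetScore

open Real Finset

section Entropy

variable {Ω : Type*} [MeasurableSpace Ω] {α β γ : Type*} [Fintype α] [Fintype β] [Fintype γ]

/-- The Shannon entropy of a random variable with values in a finite type. -/
noncomputable def entropy (P : Measure Ω) (Y : Ω → α) : ℝ :=
  ∑ b, negMulLog (P.real (Y ⁻¹' {b}))

lemma entropy_comp_equiv (P : Measure Ω) (Y : Ω → α) (e : α ≃ β) :
    entropy P (fun ω => e (Y ω)) = entropy P Y := by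
  unfold entropy
  rw [← e.sum_comp]
  refine sum_congr rfl fun b _ => ?_
  congr 2
  ext ω
  simp

lemma sum_measureReal_preimage_inter [MeasurableSpace α] [MeasurableSingletonClass α]
    (P : Measure Ω) [IsFiniteMeasure P] {Y : Ω → α} (hY : Measurable Y) (s : Set Ω) :
    ∑ b, P.real (Y ⁻¹' {b} ∩ s) = P.real s := by
  have h := sum_measureReal_preimage_singleton (μ := P.restrict s) (f := Y) univ
    (fun b _ => hY (measurableSet_singleton b))
  simpa [measureReal_restrict_apply (hY (measurableSet_singleton _))] using h

/-- The pointwise contribution to the conditional mutual information, compensated so that it is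
nonnegative. -/
noncomputable def infoGap (p a b c : ℝ) : ℝ :=
  p * (log p + log c - log a - log b) - p + a * b / c

lemma infoGap_nonneg_and_eq_zero_iff {p a b c : ℝ} (hp : 0 ≤ p) (hpa : p ≤ a) (hpb : p ≤ b)
    (hac : a ≤ c) : 0 ≤ infoGap p a b c ∧ (infoGap p a b c = 0 ↔ p * c = a * b) := by
  unfold infoGap
  rcases hp.eq_or_lt with rfl | hp
  · have hc : 0 ≤ c := hpa.trans hac
    refine ⟨by simpa using div_nonneg (mul_nonneg hpa hpb) hc, ?_⟩
    rcases hc.eq_or_lt with rfl | hc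
    · simp [le_antisymm hac hpa]
    · simp [hc.ne', eq_comm]
  · have ha : 0 < a := hp.trans_le hpa
    have hb : 0 < b := hp.trans_le hpb
    have hc : 0 < c := ha.trans_le hac
    have hq : 0 < a * b / c / p := by positivity
    have hlog : log p + log c - log a - log b = -log (a * b / c / p) := by
      rw [log_div (by positivity) hp.ne', log_div (by positivity) hc.ne',
        log_mul ha.ne' hb.ne']
      ring
    have hform : p * (log p + log c - log a - log b) - p + a * b / c
        = p * (a * b / c / p - 1 - log (a * b / c / p)) := by
      rw [hlog]
      field_simp
      ring
    rw [hform]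
    refine ⟨mul_nonneg hp.le (by linarith [log_le_sub_one_of_pos hq]), ?_⟩
    have hone : a * b / c / p = 1 ↔ p * c = a * b := by
      rw [div_eq_one_iff_eq hp.ne', div_eq_iff hc.ne', eq_comm]
    rw [← hone, mul_eq_zero, or_iff_right hp.ne']
    refine ⟨fun h => ?_, fun h => by rw [h]; simp⟩
    by_contra hne
    linarith [log_lt_sub_one_of_pos hq hne]

lemma sum_infoGap (p : γ → α → β → ℝ) :
    ∑ z, ∑ x, ∑ y, infoGap (p z x y) (∑ y, p z x y) (∑ x, p z x y) (∑ x, ∑ y, p z x y)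
      = ∑ z, (∑ x, negMulLog (∑ y, p z x y) + ∑ y, negMulLog (∑ x, p z x y)
          - ∑ x, ∑ y, negMulLog (p z x y) - negMulLog (∑ x, ∑ y, p z x y)) := by
  refine sum_congr rfl fun z _ => ?_
  have hswap : ∑ y, ∑ x, p z x y = ∑ x, ∑ y, p z x y := sum_comm
  have hquot : ∑ x, ∑ y, (∑ y, p z x y) * (∑ x, p z x y) / (∑ x, ∑ y, p z x y)
      = ∑ x, ∑ y, p z x y := by
    simp_rw [← sum_div, ← mul_sum, hswap, ← sum_mul]
    exact mul_self_div_self _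
  have hb : ∑ x, ∑ y, p z x y * log (∑ x, p z x y)
      = ∑ y, (∑ x, p z x y) * log (∑ x, p z x y) := by
    rw [sum_comm]
    simp_rw [sum_mul]
  simp only [infoGap, mul_sub, mul_add, sum_add_distrib, sum_sub_distrib, hquot, hb, negMulLog,
    neg_mul, sum_neg_distrib]
  simp only [← sum_mul]
  ring

variable [MeasurableSpace α] [MeasurableSingletonClass α] [MeasurableSpace β]
  [MeasurableSingletonClass β]

lemma entropy_cmi_nonneg_and_eq_zero_iff (P : Measure Ω) [IsFiniteMeasure P] {F : Ω → α}
    {G : Ω → β} {K : Ω → γ} (hF : Measurable F) (hG : Measurable G) :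
    let I := entropy P (fun ω => (F ω, K ω)) + entropy P (fun ω => (G ω, K ω))
      - entropy P (fun ω => ((F ω, G ω), K ω)) - entropy P K
    0 ≤ I ∧ (I = 0 ↔ ∀ x y z,
      P.real (F ⁻¹' {x} ∩ (G ⁻¹' {y} ∩ K ⁻¹' {z})) * P.real (K ⁻¹' {z})
        = P.real (F ⁻¹' {x} ∩ K ⁻¹' {z}) * P.real (G ⁻¹' {y} ∩ K ⁻¹' {z})) := by
  intro I
  set p : γ → α → β → ℝ := fun z x y => P.real (F ⁻¹' {x} ∩ (G ⁻¹' {y} ∩ K ⁻¹' {z})) with hp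
  have hFK x z : ∑ y, p z x y = P.real (F ⁻¹' {x} ∩ K ⁻¹' {z}) := by
    rw [← sum_measureReal_preimage_inter P hG]
    exact sum_congr rfl fun y _ => by rw [hp, Set.inter_left_comm]
  have hGK y z : ∑ x, p z x y = P.real (G ⁻¹' {y} ∩ K ⁻¹' {z}) :=
    sum_measureReal_preimage_inter P hF _
  have hK z : ∑ x, P.real (F ⁻¹' {x} ∩ K ⁻¹' {z}) = P.real (K ⁻¹' {z}) :=
    sum_measureReal_preimage_inter P hF _
  have hI : I = ∑ z, ∑ x, ∑ y,
      infoGap (p z x y) (∑ y, p z x y) (∑ x, p z x y) (∑ x, ∑ y, p z x y) := by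
    rw [sum_infoGap]
    simp_rw [hFK, hGK, hK]
    simp only [hp, I, entropy, Fintype.sum_prod_type_right, ← Set.singleton_prod_singleton,
      Set.mk_preimage_prod, sum_sub_distrib, sum_add_distrib, Set.inter_assoc]
    congr 2
    exact sum_congr rfl fun z _ => sum_comm
  have hgap z x y := infoGap_nonneg_and_eq_zero_iff (p := p z x y) (a := ∑ y, p z x y)
    (b := ∑ x, p z x y) (c := ∑ x, ∑ y, p z x y) measureReal_nonneg
    (single_le_sum (f := fun y => p z x y) (fun _ _ => measureReal_nonneg) (mem_univ y))
    (single_le_sum (f := fun x => p z x y) (fun _ _ => measureReal_nonneg) (mem_univ x))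
    (single_le_sum (f := fun x => ∑ y, p z x y)
      (fun _ _ => sum_nonneg fun _ _ => measureReal_nonneg) (mem_univ x))
  have hy z x := sum_nonneg fun y (_ : y ∈ univ) => (hgap z x y).1
  have hx z := sum_nonneg fun x (_ : x ∈ univ) => hy z x
  refine ⟨hI ▸ sum_nonneg fun z _ => hx z, ?_⟩
  rw [hI, sum_eq_zero_iff_of_nonneg fun z _ => hx z]
  have hzero z : ∑ x, ∑ y,
      infoGap (p z x y) (∑ y, p z x y) (∑ x, p z x y) (∑ x, ∑ y, p z x y) = 0 ↔
        ∀ x y, p z x y * (∑ x, ∑ y, p z x y) = (∑ y, p z x y) * ∑ x, p z x y := by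
    rw [sum_eq_zero_iff_of_nonneg fun x _ => hy z x]
    refine forall_congr' fun x => ?_
    rw [sum_eq_zero_iff_of_nonneg fun y _ => (hgap z x y).1]
    simp only [mem_univ, true_imp_iff, (hgap z x _).2]
  simp_rw [mem_univ, true_imp_iff, hzero, hFK, hGK, hK]
  exact ⟨fun h x y z => h z x y, fun h z x y => h x y z⟩

end Entropy

section CMI

variable {V Ω E : Type*}

/-- The tuple `(X_v)_{v ∈ S}`. -/
def tuple (X : V → Ω → E) (S : Finset V) (ω : Ω) : {x // x ∈ S} → E := fun v => X v.1 ω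

lemma cylinder_eq_preimage_tuple (X : V → Ω → E) (S : Finset V) (a : V → E) :
    cylinder X S a = tuple X S ⁻¹' {fun v => a v.1} := by
  ext ω
  simp [cylinder, tuple, funext_iff]

variable [DecidableEq V]

lemma tuple_union (X : V → Ω → E) {S T : Finset V} (h : Disjoint S T) :
    tuple X (S ∪ T)
      = fun ω => Equiv.piFinsetUnion (fun _ => E) h (tuple X S ω, tuple X T ω) := by
  funext ω
  rw [← Equiv.symm_apply_eq]
  rfl

variable [MeasurableSpace Ω]

lemma condIndepOn_iff (P : Measure Ω) [IsFiniteMeasure P] (X : V → Ω → E) {A B C : Finset V}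
    (hA : A.Nonempty) (hAB : Disjoint A B) (hAC : Disjoint A C) (hBC : Disjoint B C) :
    CondIndepOn P X A B C ↔ ∀ x y z,
      P.real (tuple X A ⁻¹' {x} ∩ (tuple X B ⁻¹' {y} ∩ tuple X C ⁻¹' {z}))
          * P.real (tuple X C ⁻¹' {z})
        = P.real (tuple X A ⁻¹' {x} ∩ tuple X C ⁻¹' {z})
          * P.real (tuple X B ⁻¹' {y} ∩ tuple X C ⁻¹' {z}) := by
  have hunion (S T : Finset V) (a : V → E) :
      cylinder X (S ∪ T) a = cylinder X S a ∩ cylinder X T a := by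
    ext ω
    simp only [cylinder, mem_union, Set.mem_ofPred_eq, Set.mem_inter_iff, or_imp, forall_and]
  have hreal : CondIndepOn P X A B C ↔ ∀ a : V → E,
      P.real (cylinder X A a ∩ (cylinder X B a ∩ cylinder X C a)) * P.real (cylinder X C a)
        = P.real (cylinder X A a ∩ cylinder X C a)
          * P.real (cylinder X B a ∩ cylinder X C a) := by
    refine forall_congr' fun a => ?_
    simp only [hunion, Set.inter_assoc, Measure.real, ← ENNReal.toReal_mul]
    exact (ENNReal.toReal_eq_toReal_iff' (ENNReal.mul_ne_top (measure_ne_top _ _)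
      (measure_ne_top _ _)) (ENNReal.mul_ne_top (measure_ne_top _ _) (measure_ne_top _ _))).symm
  simp only [hreal, cylinder_eq_preimage_tuple]
  refine ⟨fun h x y z => ?_, fun h a => h _ _ _⟩
  obtain ⟨v₀, hv₀⟩ := hA
  let a : V → E := fun v => if hvA : v ∈ A then x ⟨v, hvA⟩ else
    if hvB : v ∈ B then y ⟨v, hvB⟩ else if hvC : v ∈ C then z ⟨v, hvC⟩ else x ⟨v₀, hv₀⟩
  have hx : (fun v : {v // v ∈ A} => a v.1) = x := by
    funext v
    simp [a]
  have hy : (fun v : {v // v ∈ B} => a v.1) = y := by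
    funext v
    simp [a, disjoint_right.1 hAB v.2]
  have hz : (fun v : {v // v ∈ C} => a v.1) = z := by
    funext v
    simp [a, disjoint_right.1 hAC v.2, disjoint_right.1 hBC v.2]
  simpa only [hx, hy, hz] using h a

variable [Fintype E]

lemma jointEntropy_eq_entropy (P : Measure Ω) (X : V → Ω → E) (S : Finset V) :
    jointEntropy P X S = entropy P (tuple X S) := by
  simp only [jointEntropy, entropy, negMulLog, neg_mul, sum_neg_distrib, Measure.real]
  congr 1
  refine sum_congr rfl fun a _ => ?_
  have : {ω | ∀ v : {x // x ∈ S}, X v.1 ω = a v} = tuple X S ⁻¹' {a} := by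
    ext ω
    simp [tuple, funext_iff]
  rw [this]

lemma jointEntropy_union (P : Measure Ω) (X : V → Ω → E) {S T : Finset V} (h : Disjoint S T) :
    jointEntropy P X (S ∪ T) = entropy P fun ω => (tuple X S ω, tuple X T ω) := by
  rw [jointEntropy_eq_entropy, tuple_union X h]
  exact entropy_comp_equiv P (fun ω => (tuple X S ω, tuple X T ω)) _

lemma jointEntropy_union_union (P : Measure Ω) (X : V → Ω → E) {A B C : Finset V}
    (hAB : Disjoint A B) (hAC : Disjoint A C) (hBC : Disjoint B C) :
    jointEntropy P X (A ∪ B ∪ C)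
      = entropy P fun ω => ((tuple X A ω, tuple X B ω), tuple X C ω) := by
  rw [jointEntropy_union P X (disjoint_union_left.2 ⟨hAC, hBC⟩), tuple_union X hAB]
  exact entropy_comp_equiv P (fun ω => ((tuple X A ω, tuple X B ω), tuple X C ω))
    ((Equiv.piFinsetUnion (fun _ => E) hAB).prodCongr (Equiv.refl _))

variable [MeasurableSpace E] [MeasurableSingletonClass E]

/-- Conditional mutual information is nonnegative and vanishes exactly under conditional
independence. -/
lemma cmi_nonneg_and_eq_zero_iff (P : Measure Ω) [IsFiniteMeasure P] {X : V → Ω → E}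
    (hX : ∀ v, Measurable (X v)) (t : CITriple V) :
    0 ≤ cmi P X t.A t.B t.C ∧
      (cmi P X t.A t.B t.C = 0 ↔ CondIndepOn P X t.A t.B t.C) := by
  have hmeas (S : Finset V) : Measurable (tuple X S) := measurable_pi_lambda _ fun v => hX v.1
  rw [condIndepOn_iff P X t.hA t.hAB t.hAC t.hBC, cmi, jointEntropy_union P X t.hAC,
    jointEntropy_union P X t.hBC, jointEntropy_union_union P X t.hAB t.hAC t.hBC,
    jointEntropy_eq_entropy P X t.C]
  exact entropy_cmi_nonneg_and_eq_zero_iff P (hmeas t.A) (hmeas t.B)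

end CMI

section Imset

variable {V : Type*} [Fintype V]

lemma imsetInner_sub (u w : Finset V → ℤ) (f : Finset V → ℝ) :
    imsetInner (fun T => u T - w T) f = imsetInner u f - imsetInner w f := by
  simp [imsetInner, sub_mul, sum_sub_distrib]

lemma abs_imsetInner_sub_le (u : Finset V → ℤ) {f g : Finset V → ℝ} {ε : ℝ}
    (h : ∀ S, |f S - g S| ≤ ε) :
    |imsetInner u f - imsetInner u g| ≤ (∑ S, |(u S : ℝ)|) * ε := by
  rw [imsetInner, imsetInner, ← sum_sub_distrib, sum_mul]
  refine (abs_sum_le_sum_abs _ _).trans (sum_le_sum fun S _ => ?_)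
  rw [← mul_sub, abs_mul]
  exact mul_le_mul_of_nonneg_left (h S) (abs_nonneg _)

variable [DecidableEq V]

lemma imsetInner_deltaImset (S : Finset V) (f : Finset V → ℝ) :
    imsetInner (deltaImset S) f = f S := by
  simp [imsetInner, deltaImset]

lemma imsetInner_semiElem (t : CITriple V) (f : Finset V → ℝ) :
    imsetInner (semiElem t) f
      = f (t.A ∪ t.C) + f (t.B ∪ t.C) - f (t.A ∪ t.B ∪ t.C) - f t.C := by
  simp only [← imsetInner_deltaImset _ f]
  simp [imsetInner, semiElem, sub_mul, add_mul, sum_sub_distrib, sum_add_distrib]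

lemma imsetInner_list_sum (L : List (CITriple V)) (f : Finset V → ℝ) :
    imsetInner (fun T => (L.map fun t => semiElem t T).sum) f
      = (L.map fun t => imsetInner (semiElem t) f).sum := by
  induction L with
  | nil => simp [imsetInner]
  | cons t L ih =>
    rw [List.map_cons, List.sum_cons, ← ih]
    simp [imsetInner, add_mul, sum_add_distrib]

end Imset

lemma eventually_mul_log_lt_mul (c : ℝ) {κ : ℝ} (hκ : 0 < κ) :
    ∀ᶠ N : ℕ in Filter.atTop, c * log N < κ * N := by
  have hC : 0 < κ / (|c| + 1) := by positivity
  have h := isLittleO_log_id_atTop.def hC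
  filter_upwards [tendsto_natCast_atTop_atTop.eventually h, Filter.eventually_gt_atTop 0]
    with N hN hpos
  have hN0 : (0 : ℝ) < N := Nat.cast_pos.2 hpos
  simp only [norm_eq_abs, id, abs_of_pos hN0] at hN
  calc c * log N ≤ |c| * |log N| := by rw [← abs_mul]; exact le_abs_self _
    _ ≤ |c| * (κ / (|c| + 1) * N) := mul_le_mul_of_nonneg_left hN (abs_nonneg c)
    _ < (|c| + 1) * (κ / (|c| + 1) * N) := by
        have : 0 < κ / (|c| + 1) * N := by positivity
        linarith
    _ = κ * N := by field_simp

/-- If the bad events of a finite family have vanishing probability and their union eventually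
covers the complement of `s N`, then `s N` has probability tending to one. -/
lemma tendsto_measure_one_of_compl_subset_iUnion {Ω ι : Type*} [MeasurableSpace Ω] [Fintype ι]
    (P : Measure Ω) [IsProbabilityMeasure P] (s : ℕ → Set Ω) (b : ι → ℕ → Set Ω)
    (hb : ∀ i, Filter.Tendsto (fun N => P (b i N)) Filter.atTop (nhds 0))
    (hs : ∀ᶠ N in Filter.atTop, (s N)ᶜ ⊆ ⋃ i, b i N) :
    Filter.Tendsto (fun N => P (s N)) Filter.atTop (nhds 1) := by
  have hsum : Filter.Tendsto (fun N => ∑ i, P (b i N)) Filter.atTop (nhds 0) := by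
    simpa using tendsto_finsetSum univ fun i _ => hb i
  have hlow : Filter.Tendsto (fun N => 1 - ∑ i, P (b i N)) Filter.atTop (nhds 1) := by
    simpa using ENNReal.Tendsto.sub tendsto_const_nhds hsum (Or.inl ENNReal.one_ne_top)
  refine tendsto_of_tendsto_of_tendsto_of_le_of_le' hlow tendsto_const_nhds ?_
    (Filter.Eventually.of_forall fun N => prob_le_one)
  filter_upwards [hs] with N hN
  rw [tsub_le_iff_right]
  calc 1 = P Set.univ := measure_univ.symm
    _ ≤ P (s N) + P (s N)ᶜ := measure_univ_le_add_compl _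
    _ ≤ P (s N) + ∑ i, P (b i N) := by
        gcongr
        exact (measure_mono hN).trans (measure_iUnion_fintype_le P _)

end ImsetScore

/-- If the entropy estimators `Ĥ_N(S)` converge in probability to
`H(S)` for every `S ⊆ V`, every triple in `L` holds under `P` and some triple in
`L'` fails, then the score `S_N = −2N⟨δ_V − u, Ĥ_N⟩ + d log N` beats
`S'_N = −2N⟨δ_V − u', Ĥ_N⟩ + d' log N` with probability tending to one. -/
theorem stmt16 {V : Type*} [Fintype V] [DecidableEq V]
    {Ω : Type*} [MeasurableSpace Ω]
    {E : Type*} [Fintype E] [DecidableEq E] [MeasurableSpace E]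
    [MeasurableSingletonClass E]
    (P : Measure Ω) [IsProbabilityMeasure P]
    (X : V → Ω → E) (hX : ∀ v, Measurable (X v))
    (Hhat : ℕ → Finset V → Ω → ℝ)
    (hconv : ∀ S : Finset V, ∀ ε : ℝ, 0 < ε →
      Filter.Tendsto (fun N : ℕ => P {ω | ε < |Hhat N S ω - jointEntropy P X S|})
        Filter.atTop (nhds 0))
    (L L' : List (CITriple V)) (d d' : ℝ)
    (hL : ∀ t ∈ L, CondIndepOn P X t.A t.B t.C)
    (hL' : ∃ t ∈ L', ¬ CondIndepOn P X t.A t.B t.C) :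
    Filter.Tendsto
      (fun N : ℕ => P {ω |
        -2 * (N : ℝ) * imsetInner
            (fun T => deltaImset Finset.univ T - (L.map fun t => semiElem t T).sum)
            (fun S => Hhat N S ω) + d * Real.log N
          < -2 * (N : ℝ) * imsetInner
              (fun T => deltaImset Finset.univ T - (L'.map fun t => semiElem t T).sum)
              (fun S => Hhat N S ω) + d' * Real.log N})
      Filter.atTop (nhds 1) := by
  have hsum (M : List (CITriple V)) :
      imsetInner (fun T => (M.map fun t => semiElem t T).sum) (jointEntropy P X)
        = (M.map fun t => cmi P X t.A t.B t.C).sum := by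
    simp only [imsetInner_list_sum, imsetInner_semiElem, cmi]
  have hLsum : (L.map fun t => cmi P X t.A t.B t.C).sum = 0 := by
    refine List.sum_eq_zero fun r hr => ?_
    obtain ⟨t, ht, rfl⟩ := List.mem_map.1 hr
    exact (cmi_nonneg_and_eq_zero_iff P hX t).2.2 (hL t ht)
  have hL'sum : 0 < (L'.map fun t => cmi P X t.A t.B t.C).sum := by
    obtain ⟨t, ht, hdep⟩ := hL'
    have hcmi := cmi_nonneg_and_eq_zero_iff P hX t
    refine (hcmi.1.lt_of_ne' (mt hcmi.2.1 hdep)).trans_le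
      (List.single_le_sum (fun r hr => ?_) _ (List.mem_map_of_mem ht))
    obtain ⟨t', -, rfl⟩ := List.mem_map.1 hr
    exact (cmi_nonneg_and_eq_zero_iff P hX t').1
  set w : Finset V → ℤ := fun T =>
    (L'.map fun t => semiElem t T).sum - (L.map fun t => semiElem t T).sum with hw
  set κ := imsetInner w (jointEntropy P X) with hκ
  have hκpos : 0 < κ := by
    rw [hκ, hw, imsetInner_sub, hsum, hsum, hLsum, sub_zero]
    exact hL'sum
  set K : ℝ := ∑ S, |(w S : ℝ)|
  have hK0 : 0 ≤ K := Finset.sum_nonneg fun S _ => abs_nonneg _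
  set ε : ℝ := κ / (2 * (K + 1)) with hε
  have hεpos : 0 < ε := by positivity
  have hKε : K * ε ≤ κ / 2 := by
    have hε' : (K + 1) * ε = κ / 2 := by
      rw [hε]
      field_simp
    linarith
  refine tendsto_measure_one_of_compl_subset_iUnion P _
    (fun S N => {ω | ε < |Hhat N S ω - jointEntropy P X S|}) (fun S => hconv S ε hεpos) ?_
  filter_upwards [eventually_mul_log_lt_mul (d - d') hκpos] with N hN
  rw [Set.compl_subset_comm]
  intro ω hω
  simp only [Set.mem_compl_iff, Set.mem_iUnion, Set.mem_ofPred_eq, not_exists, not_lt] at hω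
  have hclose := abs_imsetInner_sub_le w (f := fun S => Hhat N S ω) hω
  have hinner : κ / 2 ≤ imsetInner w fun S => Hhat N S ω := by
    linarith [(abs_le.1 hclose).1]
  have hscaled := mul_le_mul_of_nonneg_left hinner (Nat.cast_nonneg (α := ℝ) N)
  rw [hw, imsetInner_sub] at hscaled
  rw [Set.mem_ofPred_eq, imsetInner_sub, imsetInner_sub]
  linarith
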